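/- Let u be uniformly distributed on the unit sphere of R^N, let s_1,...,s_N ∈ [0,b] with s̄ = N^{-1}∑ s_k > 0 and s_k ≤ b·s̄ for all k, and let t ∈ (0, 1/2). Then Pr{ |log(∑_{k=1}^N s_k u_k²) - log s̄| ≥ t } ≤ 2·exp(-N t² / (4c(c+t))), where c = (2 log 2)·b. -/

import Mathlib

open MeasureTheory

/-- The uniform (normalized Haar) probability measure on the unit sphere of `ℝ^N`. -/
noncomputable def sphereUniform (N : ℕ) :
    Measure (Metric.sphere (0 : EuclideanSpace ℝ (Fin N)) 1) :=
  ((volume : Measure (EuclideanSpace ℝ (Fin N))).toSphere Set.univ)⁻¹ •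
    (volume : Measure (EuclideanSpace ℝ (Fin N))).toSphere

namespace SphereLogAux

lemma exp_bound {x : ℝ} (hx : x ≤ 3 / 8) : Real.exp (-(x + x ^ 2)) ≤ 1 - x := by
  have h1 : 0 < 1 - x := by linarith
  rw [Real.exp_neg, inv_le_comm₀ (Real.exp_pos _) h1, inv_le_iff_one_le_mul₀ h1]
  rcases le_total x 0 with h | h
  · have := Real.add_one_le_exp (x + x ^ 2)
    have h3 : 0 ≤ -x ^ 3 := by
      have : 0 ≤ (-x) ^ 3 := pow_nonneg (by linarith) 3
      nlinarith
    nlinarith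
  · have h2 := Real.quadratic_le_exp_of_nonneg (x := x + x ^ 2) (by positivity)
    have h4 : (1 + (x + x ^ 2) + (x + x ^ 2) ^ 2 / 2) * (1 - x) ≤
        Real.exp (x + x ^ 2) * (1 - x) := mul_le_mul_of_nonneg_right h2 h1.le
    have h5 : (1 + (x + x ^ 2) + (x + x ^ 2) ^ 2 / 2) * (1 - x) =
        1 + x ^ 2 / 2 * (1 - x - x ^ 2 - x ^ 3) := by ring
    have h6 : 0 ≤ 1 - x - x ^ 2 - x ^ 3 := by
      have : x ^ 2 ≤ (3/8) ^ 2 := pow_le_pow_left₀ h hx 2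
      have : x ^ 3 ≤ (3/8) ^ 3 := pow_le_pow_left₀ h hx 3
      norm_num at *
      linarith
    have h7 : 0 ≤ x ^ 2 / 2 * (1 - x - x ^ 2 - x ^ 3) := by positivity
    linarith

lemma factor_bound {x : ℝ} (hx : x ≤ 3 / 8) :
    √(Real.pi / (1 - x)) ≤ Real.exp ((x + x ^ 2) / 2) * √Real.pi := by
  have h1 : 0 < 1 - x := by linarith
  have h := exp_bound hx
  apply Real.sqrt_le_iff.2 ⟨by positivity, ?_⟩
  rw [mul_pow, Real.sq_sqrt Real.pi_pos.le, ← Real.exp_nat_mul, div_le_iff₀ h1]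
  have h3 : Real.exp (((2 : ℕ) : ℝ) * ((x + x ^ 2) / 2)) = Real.exp (x + x ^ 2) := by
    congr 1; push_cast; ring
  rw [h3]
  have h4 : 1 ≤ Real.exp (x + x ^ 2) * (1 - x) := by
    calc 1 = Real.exp (x + x ^ 2) * Real.exp (-(x + x ^ 2)) := by
          rw [← Real.exp_add]; simp
      _ ≤ _ := by gcongr
  nlinarith [Real.pi_pos]

lemma gauss_lintegral {N : ℕ} (a : Fin N → ℝ) (ha : ∀ k, 0 < a k) :
    ∫⁻ v : EuclideanSpace ℝ (Fin N), ENNReal.ofReal (Real.exp (-∑ k, a k * (v k) ^ 2))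
      = ENNReal.ofReal (∏ k, √(Real.pi / a k)) := by
  rw [← (PiLp.volume_preserving_toLp (Fin N)).lintegral_comp_emb
    (MeasurableEquiv.toLp 2 _).measurableEmbedding]
  have h : ∀ v : Fin N → ℝ, Real.exp (-∑ k, a k * (WithLp.toLp 2 v k) ^ 2)
      = ∏ k, Real.exp (-(a k) * (v k) ^ 2) := by
    intro v
    rw [← Real.exp_sum, ← Finset.sum_neg_distrib]
    simp
  simp_rw [h]
  rw [← ofReal_integral_eq_lintegral_ofReal]
  · rw [integral_fintype_prod_volume_eq_prod (fun k x => Real.exp (-(a k) * x ^ 2))]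
    simp_rw [integral_gaussian]
  · exact Integrable.fintype_prod (f := fun k x => Real.exp (-(a k) * x ^ 2))
      (fun k => integrable_exp_neg_mul_sq (ha k))
  · exact Filter.Eventually.of_forall fun v => Finset.prod_nonneg fun _ _ => (Real.exp_pos _).le

lemma polar {N : ℕ} (F : EuclideanSpace ℝ (Fin N) → ENNReal) [NeZero N] :
    ∫⁻ v, F v = ∫⁻ p, F ((homeomorphUnitSphereProd (EuclideanSpace ℝ (Fin N))).symm p)
      ∂((volume : Measure (EuclideanSpace ℝ (Fin N))).toSphere.prod
        (Measure.volumeIoiPow (N - 1))) := by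
  have h := (volume : Measure (EuclideanSpace ℝ (Fin N))).measurePreserving_homeomorphUnitSphereProd
  rw [finrank_euclideanSpace_fin] at h
  rw [← h.lintegral_comp_emb (Homeomorph.measurableEmbedding _)]
  simp only [Homeomorph.symm_apply_apply]
  rw [lintegral_subtype_comap (measurableSet_singleton _).compl, restrict_compl_singleton]

lemma polar_norm {N : ℕ} (x : Fin N → ℝ)
    (p : Metric.sphere (0 : EuclideanSpace ℝ (Fin N)) 1 × Set.Ioi (0 : ℝ)) :
    ∑ k, (1 - x k) *
      (((homeomorphUnitSphereProd (EuclideanSpace ℝ (Fin N))).symm p :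
        EuclideanSpace ℝ (Fin N)) k) ^ 2
    = (p.2 : ℝ) ^ 2 - (p.2 : ℝ) ^ 2 * ∑ k, x k * ((p.1 : EuclideanSpace ℝ (Fin N)) k) ^ 2 := by
  have h1 : ∑ k, ((p.1 : EuclideanSpace ℝ (Fin N)) k) ^ 2 = 1 := by
    have := EuclideanSpace.real_norm_sq_eq (p.1 : EuclideanSpace ℝ (Fin N))
    rw [← this]; simp
  simp only [homeomorphUnitSphereProd_symm_apply_coe, PiLp.smul_apply, smul_eq_mul]
  have : ∀ k, (1 - x k) * ((p.2 : ℝ) * (p.1 : EuclideanSpace ℝ (Fin N)) k) ^ 2 =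
     (p.2 : ℝ) ^ 2 * ((p.1 : EuclideanSpace ℝ (Fin N)) k) ^ 2
      - (p.2 : ℝ) ^ 2 * (x k * ((p.1 : EuclideanSpace ℝ (Fin N)) k) ^ 2) := fun k => by ring
  simp_rw [this]
  rw [Finset.sum_sub_distrib, ← Finset.mul_sum, ← Finset.mul_sum, h1, mul_one]

lemma sphere_chernoff {N : ℕ} (hN : 0 < N) (x : Fin N → ℝ) (hx : ∀ k, x k ≤ 3 / 8) :
    sphereUniform N {u | 0 ≤ ∑ k, x k * ((u : EuclideanSpace ℝ (Fin N)) k) ^ 2}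
      ≤ ENNReal.ofReal (Real.exp (∑ k, (x k + x k ^ 2) / 2)) := by
  have : NeZero N := ⟨hN.ne'⟩
  set A : Set (Metric.sphere (0 : EuclideanSpace ℝ (Fin N)) 1) :=
    {u | 0 ≤ ∑ k, x k * ((u : EuclideanSpace ℝ (Fin N)) k) ^ 2} with hA
  have hAm : MeasurableSet A := by
    apply measurableSet_le measurable_const
    apply Continuous.measurable
    fun_prop
  set σ := (volume : Measure (EuclideanSpace ℝ (Fin N))).toSphere with hσ
  set f : Set.Ioi (0 : ℝ) → ENNReal := fun r => ENNReal.ofReal (Real.exp (-(r : ℝ) ^ 2)) with hf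
  have hfm : Measurable f := by
    apply ENNReal.measurable_ofReal.comp
    apply Continuous.measurable
    fun_prop
  set K := ∫⁻ r, f r ∂(Measure.volumeIoiPow (N - 1)) with hK
  have h1 : σ A * K ≤ ENNReal.ofReal (∏ k, √(Real.pi / (1 - x k))) := by
    rw [← gauss_lintegral _ (fun k => by linarith [hx k]), polar]
    have : σ A * K = ∫⁻ p, (A.indicator 1 p.1) * f p.2 ∂(σ.prod (Measure.volumeIoiPow (N - 1))) := by
      rw [lintegral_prod_mul (measurable_one.indicator hAm).aemeasurable hfm.aemeasurable,
        lintegral_indicator_one hAm]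
    rw [this]
    apply lintegral_mono
    intro p
    dsimp only
    rw [polar_norm]
    by_cases hp : p.1 ∈ A
    · simp only [hp, Set.indicator_of_mem, Pi.one_apply, one_mul, hf]
      apply ENNReal.ofReal_le_ofReal
      apply Real.exp_le_exp.2
      have : 0 ≤ (p.2 : ℝ) ^ 2 * ∑ k, x k * ((p.1 : EuclideanSpace ℝ (Fin N)) k) ^ 2 :=
        mul_nonneg (sq_nonneg _) hp
      linarith
    · simp [hp]
  have h2 : σ Set.univ * K = ENNReal.ofReal (∏ k : Fin N, √Real.pi) := by
    have := gauss_lintegral (N := N) (fun _ => 1 - 0) (fun k => by norm_num)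
    rw [polar] at this
    simp_rw [polar_norm (fun _ => 0)] at this
    simp only [sub_zero, div_one] at this
    rw [← this]
    have : σ Set.univ * K = ∫⁻ p, 1 * f p.2 ∂(σ.prod (Measure.volumeIoiPow (N - 1))) := by
      rw [lintegral_prod_mul (f := fun _ => 1) measurable_const.aemeasurable hfm.aemeasurable,
        lintegral_one]
    rw [this]
    simp [hf, hσ]
  have h3 : ENNReal.ofReal (∏ k, √(Real.pi / (1 - x k)))
      ≤ ENNReal.ofReal (Real.exp (∑ k, (x k + x k ^ 2) / 2)) *
        ENNReal.ofReal (∏ k : Fin N, √Real.pi) := by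
    rw [← ENNReal.ofReal_mul (Real.exp_pos _).le, Real.exp_sum, ← Finset.prod_mul_distrib]
    apply ENNReal.ofReal_le_ofReal
    exact Finset.prod_le_prod (fun _ _ => Real.sqrt_nonneg _) (fun k _ => factor_bound (hx k))
  have hP : ENNReal.ofReal (∏ k : Fin N, √Real.pi) ≠ 0 := by
    have : 0 < ∏ k : Fin N, √Real.pi :=
      Finset.prod_pos fun _ _ => Real.sqrt_pos.2 Real.pi_pos
    exact (ENNReal.ofReal_pos.2 this).ne'
  have hσ0 : σ Set.univ ≠ 0 := by
    intro h; rw [h, zero_mul] at h2; exact hP h2.symm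
  have hσt : σ Set.univ ≠ ⊤ := measure_ne_top _ _
  have hK0 : K ≠ 0 := by
    intro h; rw [h, mul_zero] at h2; exact hP h2.symm
  have hKt : K ≠ ⊤ := by
    intro h; rw [h, ENNReal.mul_top hσ0] at h2; exact ENNReal.ofReal_ne_top h2.symm
  have h4 : σ A ≤ ENNReal.ofReal (Real.exp (∑ k, (x k + x k ^ 2) / 2)) * σ Set.univ := by
    rw [← ENNReal.mul_le_mul_iff_left hK0 hKt, mul_assoc, h2]
    exact h1.trans h3
  rw [sphereUniform, Measure.smul_apply, smul_eq_mul, mul_comm, ← div_eq_mul_inv]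
  exact ENNReal.div_le_of_le_mul h4

lemma sphere_tail {N : ℕ} (hN : 0 < N) (y : Fin N → ℝ) (b t : ℝ) (hb : 1 ≤ b)
    (hy : ∀ k, y k ≤ b) (hy0 : ∑ k, y k = 0) (hy2 : ∑ k, y k ^ 2 ≤ N * (b - 1))
    (ht0 : 0 < t) (ht : t < 1 / 2) :
    sphereUniform N {u | 0 ≤ ∑ k, (3 * t / 4 / b * (y k - 3 * t / 4)) *
        ((u : EuclideanSpace ℝ (Fin N)) k) ^ 2}
      ≤ ENNReal.ofReal (Real.exp (-(N * t ^ 2) /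
          (4 * (2 * Real.log 2 * b) * (2 * Real.log 2 * b + t)))) := by
  have hb0 : 0 < b := by linarith
  set d := 3 * t / 4 with hd
  have hd0 : 0 < d := by positivity
  have hd1 : d ≤ 3 / 8 := by linarith
  have hN' : (0 : ℝ) < N := by exact_mod_cast hN
  refine (sphere_chernoff hN _ ?_).trans ?_
  · intro k
    have : d / b * (y k - d) ≤ d / b * b := by
      gcongr; linarith [hy k]
    rw [div_mul_cancel₀ _ hb0.ne'] at this
    linarith
  apply ENNReal.ofReal_le_ofReal
  apply Real.exp_le_exp.2
  have e1 : ∑ k, (d / b * (y k - d) + (d / b * (y k - d)) ^ 2) / 2 =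
      (d / b) / 2 * (∑ k, y k - N * d) +
      (d / b) ^ 2 / 2 * (∑ k, y k ^ 2 - 2 * d * ∑ k, y k + N * d ^ 2) := by
    have : ∀ k, (d / b * (y k - d) + (d / b * (y k - d)) ^ 2) / 2 =
      (d / b) / 2 * (y k - d) + (d / b) ^ 2 / 2 * (y k ^ 2 - 2 * d * y k + d ^ 2) := by
      intro k; ring
    simp_rw [this]
    rw [Finset.sum_add_distrib, ← Finset.mul_sum, ← Finset.mul_sum, Finset.sum_add_distrib,
      Finset.sum_sub_distrib, Finset.sum_sub_distrib, ← Finset.mul_sum]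
    simp
  rw [e1, hy0]
  have e2 : (d / b) ^ 2 / 2 * (∑ k, y k ^ 2 - 2 * d * 0 + N * d ^ 2) ≤
      (d / b) ^ 2 / 2 * (N * (b - 1) - 2 * d * 0 + N * d ^ 2) := by gcongr
  have e3 : (d / b) / 2 * (0 - N * d) +
      (d / b) ^ 2 / 2 * (N * (b - 1) - 2 * d * 0 + N * d ^ 2) =
      - (N * (d ^ 2 * (1 - d ^ 2) / (2 * b ^ 2))) := by
    field_simp; ring
  have hl := Real.log_two_gt_d9
  have hc : 1.38 * b ≤ 2 * Real.log 2 * b := by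
    gcongr; linarith
  have hden : 7.6 * b ^ 2 ≤ 4 * (2 * Real.log 2 * b) * (2 * Real.log 2 * b + t) := by
    nlinarith
  have e4 : t ^ 2 / (4 * (2 * Real.log 2 * b) * (2 * Real.log 2 * b + t)) ≤
      t ^ 2 / (7.6 * b ^ 2) := by gcongr
  have e5 : t ^ 2 / (7.6 * b ^ 2) ≤ d ^ 2 * (1 - d ^ 2) / (2 * b ^ 2) := by
    rw [div_le_div_iff₀ (by positivity) (by positivity)]
    have : d ^ 2 ≤ 9 / 64 := by nlinarith
    have h9 : d ^ 2 = 9 / 16 * t ^ 2 := by rw [hd]; ring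
    have : 9 / 16 * t ^ 2 * (55 / 64) ≤ d ^ 2 * (1 - d ^ 2) := by
      rw [← h9]; gcongr; linarith
    have : 0 < b ^ 2 := by positivity
    have h10 : t ^ 2 * 2 ≤ d ^ 2 * (1 - d ^ 2) * 7.6 := by
      nlinarith [sq_nonneg t]
    nlinarith
  have e6 : N * (t ^ 2 / (4 * (2 * Real.log 2 * b) * (2 * Real.log 2 * b + t))) ≤
    N * (d ^ 2 * (1 - d ^ 2) / (2 * b ^ 2)) := 
    mul_le_mul_of_nonneg_left (e4.trans e5) hN'.le
  rw [neg_div, mul_div_assoc]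
  linarith

end SphereLogAux

open SphereLogAux

/-- For `u` uniform on the unit sphere of `ℝ^N`, constants `s_k ∈ [0, b]`
with mean `s̄ > 0` and `s_k ≤ b s̄`, and `t ∈ (0, 1/2)`,
`Pr{ |log (∑ s_k u_k²) - log s̄| ≥ t } ≤ 2 exp (-N t² / (4 c (c + t)))` with
`c = (2 log 2) b`. -/
theorem sphere_log_quadratic_deviation (N : ℕ) (hN : 0 < N) (s : Fin N → ℝ) (b t : ℝ)
    (hs : ∀ k, 0 ≤ s k) (hsb' : ∀ k, s k ≤ b)
    (hmean : 0 < (1 / N : ℝ) * ∑ k, s k)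
    (hsb : ∀ k, s k ≤ b * ((1 / N : ℝ) * ∑ k, s k))
    (ht0 : 0 < t) (ht : t < 1 / 2) :
    sphereUniform N
        {u | t ≤ |Real.log (∑ k, s k * ((u : EuclideanSpace ℝ (Fin N)) k) ^ 2) -
          Real.log ((1 / N : ℝ) * ∑ k, s k)|}
      ≤ ENNReal.ofReal (2 * Real.exp (-(N * t ^ 2) /
          (4 * (2 * Real.log 2 * b) * (2 * Real.log 2 * b + t)))) := by
  set m := (1 / N : ℝ) * ∑ k, s k with hm
  have hN' : (0 : ℝ) < N := by exact_mod_cast hN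
  have hsum : ∑ k, s k = N * m := by rw [hm]; field_simp
  have hb : 1 ≤ b := by
    have h : ∑ k, s k ≤ ∑ _k : Fin N, b * m := Finset.sum_le_sum fun k _ => hsb k
    simp only [Finset.sum_const, Finset.card_univ, Fintype.card_fin, nsmul_eq_mul] at h
    rw [hsum] at h
    have h2 : m ≤ b * m := le_of_mul_le_mul_left h hN'
    by_contra hlt
    push Not at hlt
    nlinarith
  have hb0 : 0 < b := by linarith
  set y : Fin N → ℝ := fun k => s k / m - 1 with hy
  have hyu : ∀ k, s k / m ≤ b := fun k => by rw [div_le_iff₀ hmean]; exact hsb k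
  have hyl : ∀ k, 0 ≤ s k / m := fun k => div_nonneg (hs k) hmean.le
  have hsm : ∑ k, s k / m = N := by
    rw [← Finset.sum_div, hsum]; field_simp
  have hy0 : ∑ k, y k = 0 := by
    simp [hy, Finset.sum_sub_distrib, hsm]
  have hy2 : ∑ k, y k ^ 2 ≤ N * (b - 1) := by
    have : ∀ k, y k ^ 2 ≤ (b - 2) * (s k / m) + 1 := by
      intro k
      have := mul_nonneg (hyl k) (sub_nonneg.2 (hyu k))
      simp only [hy]
      nlinarith
    refine (Finset.sum_le_sum fun k _ => this k).trans ?_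
    rw [Finset.sum_add_distrib, ← Finset.mul_sum, hsm]
    simp
    linarith
  have H1 := sphere_tail hN y b t hb (fun k => by simp only [hy]; linarith [hyu k]) hy0 hy2 ht0 ht
  have H2 := sphere_tail hN (fun k => - y k) b t hb
    (fun k => by simp only [hy]; linarith [hyl k]) (by simp [hy0]) (by simpa using hy2) ht0 ht
  have hd : 0 < 3 * t / 4 / b := by positivity
  refine (measure_mono (t := _ ∪ _) ?_).trans ((measure_union_le _ _).trans
    ((add_le_add H1 H2).trans ?_))
  · intro u hu
    simp only [Set.mem_ofPred_eq] at hu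
    simp only [Set.mem_union, Set.mem_ofPred_eq]
    have hu1 : ∑ k, ((u : EuclideanSpace ℝ (Fin N)) k) ^ 2 = 1 := by
      rw [← EuclideanSpace.real_norm_sq_eq (u : EuclideanSpace ℝ (Fin N))]; simp
    set Q := ∑ k, s k * ((u : EuclideanSpace ℝ (Fin N)) k) ^ 2 with hQ
    have hQ0 : 0 ≤ Q := Finset.sum_nonneg fun k _ => mul_nonneg (hs k) (sq_nonneg _)
    have hform : ∀ ε : ℝ, ∑ k, 3 * t / 4 / b * (ε * y k - 3 * t / 4) *
        ((u : EuclideanSpace ℝ (Fin N)) k) ^ 2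
        = 3 * t / 4 / b * (ε * (Q / m - 1) - 3 * t / 4) := by
      intro ε
      have : ∀ k, 3 * t / 4 / b * (ε * y k - 3 * t / 4) *
        ((u : EuclideanSpace ℝ (Fin N)) k) ^ 2 =
        3 * t / 4 / b * ε / m * (s k * ((u : EuclideanSpace ℝ (Fin N)) k) ^ 2) -
        3 * t / 4 / b * (ε + 3 * t / 4) * ((u : EuclideanSpace ℝ (Fin N)) k) ^ 2 := by
        intro k; simp only [hy]; ring
      simp_rw [this]
      rw [Finset.sum_sub_distrib, ← Finset.mul_sum, ← Finset.mul_sum, hu1, ← hQ]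
      ring
    have f1 := hform 1
    have f2 := hform (-1)
    simp only [one_mul, neg_mul] at f1 f2
    rw [f1, f2]
    rcases hQ0.eq_or_lt with h0 | hpos
    · right
      rw [← h0]
      apply mul_nonneg hd.le
      simp only [zero_div]
      linarith
    rw [← Real.log_div hpos.ne' hmean.ne'] at hu
    have hq : 0 < Q / m := div_pos hpos hmean
    rcases le_abs.1 hu with h | h
    · left
      apply mul_nonneg hd.le
      have := Real.log_le_sub_one_of_pos hq
      linarith
    · right
      apply mul_nonneg hd.le
      have h1 : Q / m ≤ Real.exp (-t) := (Real.log_le_iff_le_exp hq).1 (by linarith)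
      have h2 : Real.exp (-t) ≤ 1 - 3 * t / 4 := by
        have e := Real.quadratic_le_exp_of_nonneg ht0.le
        have h3 : 0 < 1 - 3 * t / 4 := by linarith
        rw [Real.exp_neg, inv_le_comm₀ (Real.exp_pos _) h3, inv_le_iff_one_le_mul₀ h3]
        have h4 := mul_le_mul_of_nonneg_right e h3.le
        have h5 : (1 + t + t ^ 2 / 2) * (1 - 3 * t / 4) =
            1 + t / 8 * (2 - 2 * t - 3 * t ^ 2) := by ring
        have h6 : 0 ≤ t / 8 * (2 - 2 * t - 3 * t ^ 2) :=
          mul_nonneg (by linarith) (by nlinarith)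
        linarith
      linarith
  · rw [← ENNReal.ofReal_add (Real.exp_pos _).le (Real.exp_pos _).le, ← two_mul]
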